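/- Let G be a group, N a normal subgroup of G, and let π₁, π₂, π₃ be irreducible finite-dimensional complex representations of G. If Hom_N(π₁, π₂) ≠ 0 and Hom_N(π₂, π₃) ≠ 0, then Hom_N(π₁, π₃) ≠ 0 and moreover d_{π₂} · dim Hom_N(π₁, π₃) = d_{π₃} · dim Hom_N(π₁, π₂) and d_{π₁} · dim Hom_N(π₂, π₃) = d_{π₃} · dim Hom_N(π₁, π₂); equivalently, the three ratios dim Hom_N(π₁, π₃)/(d_{π₁} d_{π₃}), dim Hom_N(π₁, π₂)/(d_{π₁} d_{π₂}) and dim Hom_N(π₂, π₃)/(d_{π₂} d_{π₃}) are all equal. -/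

import Mathlib

variable {G : Type*} [Group G]

/-- A finite-dimensional complex representation is irreducible if it is nonzero and has no
invariant subspace other than `⊥` and `⊤`. -/
def IsIrrep {V : Type*} [AddCommGroup V] [Module ℂ V] (ρ : Representation ℂ G V) : Prop :=
  Nontrivial V ∧ ∀ p : Submodule ℂ V, (∀ g : G, ∀ v ∈ p, ρ g v ∈ p) → p = ⊥ ∨ p = ⊤

/-- The space of linear maps intertwining the restrictions to a subgroup `H`. -/
def homSpace (H : Subgroup G) {V₁ V₂ : Type*} [AddCommGroup V₁] [Module ℂ V₁]
    [AddCommGroup V₂] [Module ℂ V₂] (ρ₁ : Representation ℂ G V₁)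
    (ρ₂ : Representation ℂ G V₂) : Submodule ℂ (V₁ →ₗ[ℂ] V₂) where
  carrier := {f | ∀ h ∈ H, ∀ v, f (ρ₁ h v) = ρ₂ h (f v)}
  add_mem' := by
    intro f g hf hg h hh v
    simp [hf h hh v, hg h hh v]
  zero_mem' := by intro h hh v; simp
  smul_mem' := by
    intro c f hf h hh v
    simp [hf h hh v]

section SemisimpleHom

variable {k R : Type*} [Field k] [Ring R] [Algebra k R]

variable {V W V' W' : Type*}
  [AddCommGroup W] [Module R W] [Module k W] [IsScalarTower k R W]

theorem finrank_linearMap_congr [AddCommGroup V] [Module R V] [AddCommGroup V'] [Module R V']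
    [AddCommGroup W'] [Module R W'] [Module k W'] [IsScalarTower k R W']
    (e : V ≃ₗ[R] V') (f : W ≃ₗ[R] W') :
    Module.finrank k (V →ₗ[R] W) = Module.finrank k (V' →ₗ[R] W') :=
  LinearEquiv.finrank_eq
    { e.arrowCongrAddEquiv f with
      map_smul' := fun c φ ↦ by
        ext v
        exact (f.restrictScalars k).map_smul c (φ (e.symm v)) }

/-- Twisting source and target by the same automorphism of the ring does not change the dimension
of the space of homomorphisms. -/
theorem finrank_linearMap_congr_semilinear {σ : R ≃+* R}
    [AddCommGroup V] [Module R V] [AddCommGroup V'] [Module R V']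
    (e : V →ₛₗ[(σ : R →+* R)] V') (he : Function.Bijective e)
    (f : W →ₛₗ[(σ : R →+* R)] W) (hf : Function.Bijective f)
    (hfk : ∀ (c : k) w, f (c • w) = c • f w) :
    Module.finrank k (V →ₗ[R] W) = Module.finrank k (V' →ₗ[R] W) := by
  have := RingHomInvPair.of_ringEquiv σ
  have := RingHomInvPair.of_ringEquiv_symm σ
  exact LinearEquiv.finrank_eq
    { (LinearEquiv.ofBijective e he).arrowCongrAddEquiv (LinearEquiv.ofBijective f hf) with
      map_smul' := fun c φ ↦ by
        ext v
        exact hfk c _ }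

variable [AddCommGroup V] [Module R V] [Module k V] [IsScalarTower k R V]

variable (k R V W) in
theorem Module.Finite.linearMap_of_isScalarTower [Module.Finite k V] [Module.Finite k W] :
    Module.Finite k (V →ₗ[R] W) :=
  Module.Finite.of_injective (LinearMap.restrictScalarsₗ k R V W k)
    (LinearMap.restrictScalars_injective k)

theorem Submodule.finite_of_isScalarTower [Module.Finite k V] (p : Submodule R V) :
    Module.Finite k p :=
  Module.Finite.of_injective (p.subtype.restrictScalars k) p.subtype_injective

theorem finrank_linearMap_pi_left {ι : Type*} [Fintype ι] (S : ι → Type*)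
    [∀ i, AddCommGroup (S i)] [∀ i, Module R (S i)] [∀ i, Module k (S i)]
    [∀ i, IsScalarTower k R (S i)] [∀ i, Module.Finite k (S i)] [Module.Finite k W] :
    Module.finrank k ((∀ i, S i) →ₗ[R] W) = ∑ i, Module.finrank k (S i →ₗ[R] W) := by
  classical
  have (i : ι) := Module.Finite.linearMap_of_isScalarTower k R (S i) W
  rw [← (LinearMap.lsum R S k (M := W)).finrank_eq, Module.finrank_pi_fintype]

theorem finrank_linearMap_pi_right {ι : Type*} [Fintype ι] (S : ι → Type*)
    [∀ i, AddCommGroup (S i)] [∀ i, Module R (S i)] [∀ i, Module k (S i)]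
    [∀ i, IsScalarTower k R (S i)] [∀ i, Module.Finite k (S i)] [Module.Finite k V] :
    Module.finrank k (V →ₗ[R] (∀ i, S i)) = ∑ i, Module.finrank k (V →ₗ[R] S i) := by
  have (i : ι) := Module.Finite.linearMap_of_isScalarTower k R V (S i)
  rw [← Module.finrank_pi_fintype]
  exact LinearEquiv.finrank_eq
    { toFun := fun f i ↦ LinearMap.proj i ∘ₗ f
      invFun := LinearMap.pi
      map_add' := fun _ _ ↦ rfl
      map_smul' := fun _ _ ↦ rfl
      left_inv := fun _ ↦ rfl
      right_inv := fun _ ↦ rfl }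

theorem IsSimpleModule.finrank_linearMap_comm [IsSimpleModule R V] [IsSimpleModule R W] :
    Module.finrank k (V →ₗ[R] W) = Module.finrank k (W →ₗ[R] V) := by
  by_cases h : Nonempty (V ≃ₗ[R] W)
  · obtain ⟨e⟩ := h
    exact finrank_linearMap_congr e e.symm
  · have h₁ : Subsingleton (V →ₗ[R] W) := subsingleton_of_forall_eq 0 fun f ↦
      (LinearMap.bijective_or_eq_zero f).resolve_left fun hf ↦ h ⟨.ofBijective f hf⟩
    have h₂ : Subsingleton (W →ₗ[R] V) := subsingleton_of_forall_eq 0 fun f ↦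
      (LinearMap.bijective_or_eq_zero f).resolve_left fun hf ↦
        h ⟨(LinearEquiv.ofBijective f hf).symm⟩
    rw [Module.finrank_zero_of_subsingleton, Module.finrank_zero_of_subsingleton]

variable (k R V) in
theorem IsSemisimpleModule.exists_linearEquiv_fin_pi [IsSemisimpleModule R V]
    [Module.Finite k V] : ∃ (n : ℕ) (S : Fin n → Submodule R V),
      (∀ i, IsSimpleModule R (S i)) ∧ Nonempty (V ≃ₗ[R] ∀ i, S i) := by
  have : Module.Finite R V := Module.Finite.of_restrictScalars_finite k R V
  obtain ⟨n, S, e, hS⟩ := IsSemisimpleModule.exists_linearEquiv_fin_dfinsupp R V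
  exact ⟨n, S, hS, ⟨e.trans (DFinsupp.linearEquivFunOnFintype (R := R))⟩⟩

theorem IsSemisimpleModule.finrank_linearMap_comm [IsSemisimpleModule R V]
    [IsSemisimpleModule R W] [Module.Finite k V] [Module.Finite k W] :
    Module.finrank k (V →ₗ[R] W) = Module.finrank k (W →ₗ[R] V) := by
  obtain ⟨m, S, hS, ⟨e⟩⟩ := exists_linearEquiv_fin_pi k R V
  obtain ⟨n, T, hT, ⟨f⟩⟩ := exists_linearEquiv_fin_pi k R W
  have (i : Fin _) := (S i).finite_of_isScalarTower (k := k)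
  have (j : Fin _) := (T j).finite_of_isScalarTower (k := k)
  rw [finrank_linearMap_congr e f, finrank_linearMap_congr f e, finrank_linearMap_pi_left,
    finrank_linearMap_pi_right]
  refine Finset.sum_congr rfl fun i _ ↦ ?_
  rw [finrank_linearMap_pi_left, finrank_linearMap_pi_right]
  exact Finset.sum_congr rfl fun j _ ↦ IsSimpleModule.finrank_linearMap_comm

/-- If all simple submodules of a semisimple module `V` have the same dimension `s` and the same
multiplicity `m` in `W`, then `dim Hom(V, W)` is to `m` as `dim V` is to `s`. -/
theorem IsSemisimpleModule.mul_finrank_linearMap [IsSemisimpleModule R V]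
    [Module.Finite k V] [Module.Finite k W] {s m : ℕ}
    (hs : ∀ T : Submodule R V, IsSimpleModule R T → Module.finrank k T = s)
    (hm : ∀ T : Submodule R V, IsSimpleModule R T → Module.finrank k (T →ₗ[R] W) = m) :
    s * Module.finrank k (V →ₗ[R] W) = Module.finrank k V * m := by
  obtain ⟨n, S, hS, ⟨e⟩⟩ := exists_linearEquiv_fin_pi k R V
  have (i : Fin _) := (S i).finite_of_isScalarTower (k := k)
  rw [finrank_linearMap_congr e (.refl R W), finrank_linearMap_pi_left,
    (e.restrictScalars k).finrank_eq, Module.finrank_pi_fintype]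
  simp only [hs _ (hS _), hm _ (hS _), Finset.sum_const, smul_eq_mul]
  ring

end SemisimpleHom

section Clifford

variable {k R Γ : Type*} [Field k] [Ring R] [Group Γ] {σ : Γ → R ≃+* R} {V W : Type*}
  [AddCommGroup V] [Module R V] [Module k V] [AddCommGroup W] [Module R W] [Module k W]

/-- An element of a group acting semilinearly, as a semilinear map. -/
def Representation.semilinearMap (ρ : Representation k Γ V)
    (hρ : ∀ g (r : R) v, ρ g (r • v) = σ g r • ρ g v) (g : Γ) :
    V →ₛₗ[(σ g : R →+* R)] V where
  toFun := ρ g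
  map_add' := map_add _
  map_smul' := hρ g

theorem Representation.semilinearMap_bijective (ρ : Representation k Γ V)
    (hρ : ∀ g (r : R) v, ρ g (r • v) = σ g r • ρ g v) (g : Γ) :
    Function.Bijective (ρ.semilinearMap hρ g) :=
  ρ.apply_bijective g

/-- **Clifford's theorem**, for a group acting semilinearly on a module: if the module has no
proper nonzero invariant submodule, it is the sum of the translates of any simple submodule. -/
theorem Representation.iSup_map_semilinearMap_eq_top (ρ : Representation k Γ V)
    (hρ : ∀ g (r : R) v, ρ g (r • v) = σ g r • ρ g v)
    (hirr : ∀ p : Submodule R V, (∀ g, ∀ v ∈ p, ρ g v ∈ p) → p = ⊥ ∨ p = ⊤)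
    {S : Submodule R V} (hS : S ≠ ⊥) :
    ⨆ g, S.map (ρ.semilinearMap hρ g) = ⊤ := by
  refine (hirr _ fun g ↦ ?_).resolve_left fun h ↦ hS ?_
  · change (⨆ g, S.map (ρ.semilinearMap hρ g)) ≤
      (⨆ g, S.map (ρ.semilinearMap hρ g)).comap (ρ.semilinearMap hρ g)
    refine iSup_le fun h ↦ ?_
    rintro _ ⟨v, hv, rfl⟩
    refine Submodule.mem_iSup_of_mem (g * h) ⟨v, hv, ?_⟩
    exact LinearMap.congr_fun (map_mul ρ g h) v
  · rw [iSup_eq_bot] at h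
    rw [eq_bot_iff, ← h 1]
    exact fun v hv ↦ ⟨v, hv, LinearMap.congr_fun (map_one ρ) v⟩

theorem Submodule.bijective_restrict_map {R₂ M M₂ : Type*} [Ring R₂] [AddCommGroup M] [Module R M]
    [AddCommGroup M₂] [Module R₂ M₂] {τ : R →+* R₂} [RingHomSurjective τ] (f : M →ₛₗ[τ] M₂)
    (hf : Function.Injective f) (p : Submodule R M) :
    Function.Bijective (f.restrict (p := p) (q := p.map f) fun _ ↦ Submodule.mem_map_of_mem) := by
  refine ⟨fun x y h ↦ Subtype.ext (hf (congrArg Subtype.val h)), ?_⟩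
  rintro ⟨_, v, hv, rfl⟩
  exact ⟨⟨v, hv⟩, rfl⟩

theorem Representation.isSimpleModule_map (ρ : Representation k Γ V)
    (hρ : ∀ g (r : R) v, ρ g (r • v) = σ g r • ρ g v) (g : Γ)
    (S : Submodule R V) [IsSimpleModule R S] :
    IsSimpleModule R (S.map (ρ.semilinearMap hρ g)) :=
  (LinearMap.isSimpleModule_iff_of_bijective _ (S.bijective_restrict_map _
    (ρ.semilinearMap_bijective hρ g).injective)).mp ‹_›

theorem Representation.isSemisimpleModule (ρ : Representation k Γ V)
    (hρ : ∀ g (r : R) v, ρ g (r • v) = σ g r • ρ g v)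
    (hirr : ∀ p : Submodule R V, (∀ g, ∀ v ∈ p, ρ g v ∈ p) → p = ⊥ ∨ p = ⊤)
    (S : Submodule R V) [IsSimpleModule R S] : IsSemisimpleModule R V :=
  isSemisimpleModule_of_isSemisimpleModule_submodule'
    (fun g ↦ have := ρ.isSimpleModule_map hρ g S; inferInstance)
    (ρ.iSup_map_semilinearMap_eq_top hρ hirr (isSimpleModule_iff_isAtom.mp ‹IsSimpleModule R S›).1)

theorem Representation.exists_linearEquiv_map (ρ : Representation k Γ V)
    (hρ : ∀ g (r : R) v, ρ g (r • v) = σ g r • ρ g v)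
    (hirr : ∀ p : Submodule R V, (∀ g, ∀ v ∈ p, ρ g v ∈ p) → p = ⊥ ∨ p = ⊤)
    (S T : Submodule R V) [IsSimpleModule R S] [IsSimpleModule R T] :
    ∃ g, Nonempty (T ≃ₗ[R] S.map (ρ.semilinearMap hρ g)) := by
  have : ∀ m : Set.range fun g ↦ S.map (ρ.semilinearMap hρ g), IsSimpleModule R m := by
    rintro ⟨_, g, rfl⟩
    exact ρ.isSimpleModule_map hρ g S
  obtain ⟨_, ⟨g, rfl⟩, e⟩ := T.linearEquiv_of_sSup_eq_top _ <|
    ρ.iSup_map_semilinearMap_eq_top hρ hirr (isSimpleModule_iff_isAtom.mp ‹IsSimpleModule R S›).1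
  exact ⟨g, e⟩

variable [Algebra k R] [IsScalarTower k R V] [IsScalarTower k R W]

/-- For `V` irreducible under a semilinear group action, with simple submodule `S`, and any `W`
with a compatible action, `dim Hom(V, W) / dim V = dim Hom(S, W) / dim S`. -/
theorem Representation.finrank_mul_finrank_linearMap [Module.Finite k V] [Module.Finite k W]
    (ρ : Representation k Γ V) (hρ : ∀ g (r : R) v, ρ g (r • v) = σ g r • ρ g v)
    (hirr : ∀ p : Submodule R V, (∀ g, ∀ v ∈ p, ρ g v ∈ p) → p = ⊥ ∨ p = ⊤)
    (τ : Representation k Γ W) (hτ : ∀ g (r : R) w, τ g (r • w) = σ g r • τ g w)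
    (S : Submodule R V) [IsSimpleModule R S] :
    Module.finrank k S * Module.finrank k (V →ₗ[R] W) =
      Module.finrank k V * Module.finrank k (S →ₗ[R] W) := by
  have := ρ.isSemisimpleModule hρ hirr S
  refine IsSemisimpleModule.mul_finrank_linearMap (fun T _ ↦ ?_) (fun T _ ↦ ?_) <;>
    obtain ⟨g, ⟨e⟩⟩ := ρ.exists_linearEquiv_map hρ hirr S T
  · rw [(e.restrictScalars k).finrank_eq]
    let f : S →ₗ[k] S.map (ρ.semilinearMap hρ g) :=
      { toFun := fun v ↦ ⟨ρ g v, Submodule.mem_map_of_mem (f := ρ.semilinearMap hρ g) v.2⟩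
        map_add' := fun _ _ ↦ Subtype.ext (map_add _ _ _)
        map_smul' := fun c v ↦ Subtype.ext ((ρ g).map_smul c v) }
    exact (LinearEquiv.ofBijective f (S.bijective_restrict_map _
      (ρ.semilinearMap_bijective hρ g).injective)).finrank_eq.symm
  · rw [finrank_linearMap_congr e (.refl R W)]
    exact (finrank_linearMap_congr_semilinear _ (S.bijective_restrict_map _
      (ρ.semilinearMap_bijective hρ g).injective) (τ.semilinearMap hτ g)
      (τ.semilinearMap_bijective hτ g) (τ g).map_smul).symm

theorem exists_isSimpleModule_submodule_linearEquiv {S : Type*} [AddCommGroup S] [Module R S]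
    [IsSimpleModule R S] (h : Module.finrank k (S →ₗ[R] W) ≠ 0) :
    ∃ T : Submodule R W, IsSimpleModule R T ∧ Nonempty (S ≃ₗ[R] T) := by
  obtain ⟨f, hf⟩ : ∃ f : S →ₗ[R] W, f ≠ 0 := by
    by_contra! hzero
    have := subsingleton_of_forall_eq 0 hzero
    exact h Module.finrank_zero_of_subsingleton
  let e := LinearEquiv.ofInjective f (LinearMap.injective_of_ne_zero hf)
  exact ⟨LinearMap.range f, IsSimpleModule.congr e.symm, ⟨e⟩⟩

theorem Representation.finrank_linearMap_trans {V₁ V₂ V₃ : Type*}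
    [AddCommGroup V₁] [Module R V₁] [Module k V₁] [IsScalarTower k R V₁] [Module.Finite k V₁]
    [AddCommGroup V₂] [Module R V₂] [Module k V₂] [IsScalarTower k R V₂] [Module.Finite k V₂]
    [AddCommGroup V₃] [Module R V₃] [Module k V₃] [IsScalarTower k R V₃] [Module.Finite k V₃]
    [Nontrivial V₁] [Nontrivial V₂]
    (ρ₁ : Representation k Γ V₁) (hρ₁ : ∀ g (r : R) v, ρ₁ g (r • v) = σ g r • ρ₁ g v)
    (ρ₂ : Representation k Γ V₂) (hρ₂ : ∀ g (r : R) v, ρ₂ g (r • v) = σ g r • ρ₂ g v)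
    (ρ₃ : Representation k Γ V₃) (hρ₃ : ∀ g (r : R) v, ρ₃ g (r • v) = σ g r • ρ₃ g v)
    (h₁ : ∀ p : Submodule R V₁, (∀ g, ∀ v ∈ p, ρ₁ g v ∈ p) → p = ⊥ ∨ p = ⊤)
    (h₂ : ∀ p : Submodule R V₂, (∀ g, ∀ v ∈ p, ρ₂ g v ∈ p) → p = ⊥ ∨ p = ⊤)
    (h₃ : ∀ p : Submodule R V₃, (∀ g, ∀ v ∈ p, ρ₃ g v ∈ p) → p = ⊥ ∨ p = ⊤)
    (h₁₂ : Module.finrank k (V₁ →ₗ[R] V₂) ≠ 0) (h₂₃ : Module.finrank k (V₂ →ₗ[R] V₃) ≠ 0) :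
    Module.finrank k (V₁ →ₗ[R] V₃) ≠ 0 ∧
      Module.finrank k V₂ * Module.finrank k (V₁ →ₗ[R] V₃) =
        Module.finrank k V₃ * Module.finrank k (V₁ →ₗ[R] V₂) ∧
      Module.finrank k V₁ * Module.finrank k (V₂ →ₗ[R] V₃) =
        Module.finrank k V₃ * Module.finrank k (V₁ →ₗ[R] V₂) := by
  have : IsArtinian R V₁ := isArtinian_of_tower k inferInstance
  obtain ⟨S, hS⟩ := IsAtomic.exists_atom (Submodule R V₁)
  have hS : IsSimpleModule R S := isSimpleModule_iff_isAtom.mpr hS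
  have := IsSimpleModule.nontrivial R S
  have := S.finite_of_isScalarTower (k := k)
  have hs : Module.finrank k S ≠ 0 := Module.finrank_pos.ne'
  have hd₁ : Module.finrank k V₁ ≠ 0 := Module.finrank_pos.ne'
  have hd₂ : Module.finrank k V₂ ≠ 0 := Module.finrank_pos.ne'
  have e₁₂ := ρ₁.finrank_mul_finrank_linearMap hρ₁ h₁ ρ₂ hρ₂ S
  have e₁₃ := ρ₁.finrank_mul_finrank_linearMap hρ₁ h₁ ρ₃ hρ₃ S
  obtain ⟨T, hT, ⟨eT⟩⟩ := exists_isSimpleModule_submodule_linearEquiv (k := k)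
    (S := S) (W := V₂) fun h ↦ mul_ne_zero hs h₁₂ (by rw [e₁₂, h, mul_zero])
  have e₂₃ := ρ₂.finrank_mul_finrank_linearMap hρ₂ h₂ ρ₃ hρ₃ T
  rw [← (eT.restrictScalars k).finrank_eq, ← finrank_linearMap_congr eT (.refl R V₃)] at e₂₃
  have hm₃ : Module.finrank k (S →ₗ[R] V₃) ≠ 0 := fun h ↦
    mul_ne_zero hs h₂₃ (by rw [e₂₃, h, mul_zero])
  obtain ⟨U, hU, ⟨eU⟩⟩ := exists_isSimpleModule_submodule_linearEquiv hm₃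
  have e₃₂ := ρ₃.finrank_mul_finrank_linearMap hρ₃ h₃ ρ₂ hρ₂ U
  have := ρ₂.isSemisimpleModule hρ₂ h₂ T
  have := ρ₃.isSemisimpleModule hρ₃ h₃ U
  rw [← (eU.restrictScalars k).finrank_eq, ← finrank_linearMap_congr eU (.refl R V₂),
    IsSemisimpleModule.finrank_linearMap_comm, e₂₃] at e₃₂
  refine ⟨fun h ↦ mul_ne_zero hd₁ hm₃ (by rw [← e₁₃, h, mul_zero]),
    mul_left_cancel₀ hs ?_, mul_left_cancel₀ hs ?_⟩
  · rw [mul_left_comm, e₁₃, mul_left_comm _ (Module.finrank k V₃), e₁₂, mul_left_comm, e₃₂,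
      mul_left_comm]
  · rw [mul_left_comm, e₂₃, mul_left_comm _ (Module.finrank k V₃), e₁₂, e₃₂, mul_left_comm]

end Clifford

/-- Conjugation by `g` on the group algebra of a normal subgroup. -/
noncomputable def conjGroupAlgebra (N : Subgroup G) [N.Normal] (g : G) :
    MonoidAlgebra ℂ N ≃+* MonoidAlgebra ℂ N :=
  (MonoidAlgebra.domCongr ℂ ℂ (MulAut.conjNormal g : N ≃* N)).toRingEquiv

section NormalSubgroup

variable {V W : Type*} [AddCommGroup V] [Module ℂ V] [AddCommGroup W] [Module ℂ W]

/-- The algebra homomorphism from the group algebra of `N` given by the restriction of `ρ`. -/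
noncomputable def resAlgHom (N : Subgroup G) (ρ : Representation ℂ G V) :
    MonoidAlgebra ℂ N →ₐ[ℂ] Module.End ℂ V :=
  MonoidAlgebra.lift ℂ (Module.End ℂ V) N (ρ.comp N.subtype)

theorem resAlgHom_single (N : Subgroup G) (ρ : Representation ℂ G V) (n : N) (a : ℂ) :
    resAlgHom N ρ (MonoidAlgebra.single n a) = a • ρ n :=
  MonoidAlgebra.lift_single ..

/-- The restriction of `ρ` to `N`, as a module over the group algebra of `N`. -/
noncomputable abbrev resModule (N : Subgroup G) (ρ : Representation ℂ G V) :
    Module (MonoidAlgebra ℂ N) V :=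
  Module.compHom V (resAlgHom N ρ).toRingHom

theorem resModule_isScalarTower (N : Subgroup G) (ρ : Representation ℂ G V) :
    letI := resModule N ρ
    IsScalarTower ℂ (MonoidAlgebra ℂ N) V :=
  letI := resModule N ρ
  ⟨fun c r v ↦ LinearMap.congr_fun (map_smul (resAlgHom N ρ) c r) v⟩

theorem apply_resAlgHom (N : Subgroup G) [N.Normal] (ρ : Representation ℂ G V) (g : G)
    (r : MonoidAlgebra ℂ N) (v : V) :
    ρ g (resAlgHom N ρ r v) = resAlgHom N ρ (conjGroupAlgebra N g r) (ρ g v) := by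
  induction r using MonoidAlgebra.induction_linear with
  | zero => simp
  | add x y hx hy => simp only [map_add, LinearMap.add_apply, hx, hy]
  | single n a =>
    have h : conjGroupAlgebra N g (MonoidAlgebra.single n a) =
        MonoidAlgebra.single (MulAut.conjNormal g n) a :=
      MonoidAlgebra.domCongr_single (R := ℂ) ..
    rw [h, resAlgHom_single, resAlgHom_single, LinearMap.smul_apply, LinearMap.smul_apply,
      map_smul, MulAut.conjNormal_apply, ← Module.End.mul_apply, ← Module.End.mul_apply, ← map_mul,
      ← map_mul, inv_mul_cancel_right]

theorem IsIrrep.eq_bot_or_eq_top {ρ : Representation ℂ G V} (h : IsIrrep ρ) (N : Subgroup G) :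
    letI := resModule N ρ
    ∀ p : Submodule (MonoidAlgebra ℂ N) V, (∀ g, ∀ v ∈ p, ρ g v ∈ p) → p = ⊥ ∨ p = ⊤ :=
  letI := resModule N ρ
  have := resModule_isScalarTower N ρ
  fun p hp ↦ (h.2 (p.restrictScalars ℂ) hp).imp (Submodule.restrictScalars_eq_bot_iff ..).mp
    (Submodule.restrictScalars_eq_top_iff ..).mp

theorem apply_resAlgHom_of_mem_homSpace {N : Subgroup G} {ρ : Representation ℂ G V}
    {τ : Representation ℂ G W} {f : V →ₗ[ℂ] W} (hf : f ∈ homSpace N ρ τ)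
    (r : MonoidAlgebra ℂ N) (v : V) : f (resAlgHom N ρ r v) = resAlgHom N τ r (f v) := by
  induction r using MonoidAlgebra.induction_linear with
  | zero => simp
  | add x y hx hy => simp only [map_add, LinearMap.add_apply, hx, hy]
  | single n a =>
    rw [resAlgHom_single, resAlgHom_single, LinearMap.smul_apply, LinearMap.smul_apply, map_smul,
      hf n n.2]

/-- Intertwining maps for `N` are the linear maps over its group algebra. -/
theorem finrank_homSpace (N : Subgroup G) (ρ : Representation ℂ G V)
    (τ : Representation ℂ G W) :
    letI := resModule N ρ
    letI := resModule N τ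
    haveI := resModule_isScalarTower N τ
    Module.finrank ℂ (homSpace N ρ τ) = Module.finrank ℂ (V →ₗ[MonoidAlgebra ℂ N] W) :=
  letI := resModule N ρ
  letI := resModule N τ
  have := resModule_isScalarTower N ρ
  have := resModule_isScalarTower N τ
  LinearEquiv.finrank_eq
    { toFun := fun f ↦
        { toFun := f.1
          map_add' := map_add f.1
          map_smul' := apply_resAlgHom_of_mem_homSpace f.2 }
      invFun := fun f ↦ ⟨f.restrictScalars ℂ, fun n hn v ↦ by
        have h := f.map_smul (MonoidAlgebra.single ⟨n, hn⟩ 1) v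
        change f (resAlgHom N ρ _ v) = resAlgHom N τ _ (f v) at h
        rwa [resAlgHom_single, resAlgHom_single, one_smul, one_smul] at h⟩
      map_add' := fun _ _ ↦ rfl
      map_smul' := fun _ _ ↦ rfl
      left_inv := fun _ ↦ rfl
      right_inv := fun _ ↦ rfl }

end NormalSubgroup

/-- transitivity of nonvanishing of `Hom_N` together with the equality of the
normalized dimensions. -/
theorem stmt2 {V₁ V₂ V₃ : Type*} [AddCommGroup V₁] [Module ℂ V₁] [FiniteDimensional ℂ V₁]
    [AddCommGroup V₂] [Module ℂ V₂] [FiniteDimensional ℂ V₂]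
    [AddCommGroup V₃] [Module ℂ V₃] [FiniteDimensional ℂ V₃]
    (N : Subgroup G) [N.Normal]
    (ρ₁ : Representation ℂ G V₁) (ρ₂ : Representation ℂ G V₂) (ρ₃ : Representation ℂ G V₃)
    (h₁ : IsIrrep ρ₁) (h₂ : IsIrrep ρ₂) (h₃ : IsIrrep ρ₃)
    (h12 : homSpace N ρ₁ ρ₂ ≠ ⊥) (h23 : homSpace N ρ₂ ρ₃ ≠ ⊥) :
    homSpace N ρ₁ ρ₃ ≠ ⊥ ∧
      Module.finrank ℂ V₂ * Module.finrank ℂ (homSpace N ρ₁ ρ₃) =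
        Module.finrank ℂ V₃ * Module.finrank ℂ (homSpace N ρ₁ ρ₂) ∧
      Module.finrank ℂ V₁ * Module.finrank ℂ (homSpace N ρ₂ ρ₃) =
        Module.finrank ℂ V₃ * Module.finrank ℂ (homSpace N ρ₁ ρ₂) := by
  have := h₁.1
  have := h₂.1
  let := resModule N ρ₁
  let := resModule N ρ₂
  let := resModule N ρ₃
  have := resModule_isScalarTower N ρ₁
  have := resModule_isScalarTower N ρ₂
  have := resModule_isScalarTower N ρ₃
  rw [← Submodule.one_le_finrank_iff, Nat.one_le_iff_ne_zero, finrank_homSpace] at h12 h23 ⊢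
  rw [finrank_homSpace, finrank_homSpace]
  exact ρ₁.finrank_linearMap_trans (apply_resAlgHom N ρ₁) ρ₂ (apply_resAlgHom N ρ₂)
    ρ₃ (apply_resAlgHom N ρ₃) (h₁.eq_bot_or_eq_top N) (h₂.eq_bot_or_eq_top N)
    (h₃.eq_bot_or_eq_top N) h12 h23
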